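/- (Tensor-product case, achievability part, Eq. (previous_result).) Let dA dB : ℕ with dA ≥ 1 and dB ≥ 1, let ι := Fin dA × Fin dB, and let ρ : Matrix ι ι ℂ be Hermitian, positive semidefinite, with trace 1. Let p : Fin (dA · dB) → ℝ be the eigenvalues of ρ listed in decreasing order and set q j := Σ_{a : Fin dA} p (j · dA + a) for j : Fin dB. Then there exists a unitary matrix U in the unitary group of Matrix ι ι ℂ such that S(Tr_A (U ρ U*)) = Σ_{j : Fin dB} (− q j · Real.log (q j)); consequently this value is the minimum of S(Tr_A (U ρ U*)) over all unitaries U. -/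

import Mathlib

open scoped Classical Matrix ComplexOrder

namespace AQD

/-- Von Neumann entropy of a (Hermitian) matrix: `∑ i, -λ_i log λ_i` where `λ` are the
eigenvalues; defined to be `0` on non-Hermitian matrices. -/
noncomputable def vnEntropy {n : Type*} [Fintype n] [DecidableEq n] (M : Matrix n n ℂ) : ℝ :=
  if hM : M.IsHermitian then ∑ i, (- hM.eigenvalues i * Real.log (hM.eigenvalues i)) else 0

/-- The index `j * dA + a` as an element of `Fin (dA * dB)`. -/
def idx2 (dA dB : ℕ) (b : Fin dB) (a : Fin dA) : Fin (dA * dB) :=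
  ⟨(b : ℕ) * dA + (a : ℕ), by
    have ha := a.isLt
    have hb := b.isLt
    calc (b : ℕ) * dA + (a : ℕ) < ((b : ℕ) + 1) * dA := by rw [Nat.add_mul, Nat.one_mul]; omega
      _ ≤ dB * dA := Nat.mul_le_mul_right _ hb
      _ = dA * dB := Nat.mul_comm _ _⟩

/-- Partial trace over subsystem `A` for the tensor-product index `Fin dA × Fin dB`. -/
noncomputable def ptraceProd (dA dB : ℕ)
    (M : Matrix (Fin dA × Fin dB) (Fin dA × Fin dB) ℂ) : Matrix (Fin dB) (Fin dB) ℂ :=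
  fun b b' => ∑ a : Fin dA, M (a, b) (a, b')

lemma normSq_mem_doublyStochastic {n : Type*} [Fintype n] [DecidableEq n] {W : Matrix n n ℂ}
    (hW : W ∈ Matrix.unitaryGroup n ℂ) :
    (Matrix.of fun x y => Complex.normSq (W x y)) ∈ doublyStochastic ℝ n := by
  rw [mem_doublyStochastic_iff_sum]
  refine ⟨fun i j => Complex.normSq_nonneg _, fun i => ?_, fun j => ?_⟩
  · have h := congrFun (congrFun (Matrix.mem_unitaryGroup_iff.1 hW) i) i
    simp only [Matrix.mul_apply, Matrix.star_apply, Matrix.one_apply_eq, RCLike.star_def,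
      Complex.mul_conj] at h
    simpa only [Matrix.of_apply] using by exact_mod_cast h
  · have h := congrFun (congrFun (Matrix.mem_unitaryGroup_iff'.1 hW) j) j
    simp only [Matrix.mul_apply, Matrix.star_apply, Matrix.one_apply_eq, RCLike.star_def,
      mul_comm ((starRingEnd ℂ) _), Complex.mul_conj] at h
    simpa only [Matrix.of_apply] using by exact_mod_cast h

/-- Rearrangement inequality for a doubly stochastic matrix in place of a permutation. -/
lemma sum_mul_le_of_mem_doublyStochastic {n : Type*} [Fintype n] [DecidableEq n]
    {D : Matrix n n ℝ} (hD : D ∈ doublyStochastic ℝ n) {u v : n → ℝ} (huv : Antivary u v)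
    (h : Equiv.Perm n) :
    ∑ i, u i * v i ≤ ∑ i, (∑ j, D i j * u (h j)) * v i := by
  obtain ⟨w, hw0, hw1, rfl⟩ := exists_eq_sum_perm_of_mem_doublyStochastic hD
  have key : ∀ σ : Equiv.Perm n, ∑ i, u i * v i ≤ ∑ i, u (h (σ i)) * v i := fun σ =>
    huv.sum_mul_le_sum_comp_perm_mul (σ := σ.trans h)
  calc ∑ i, u i * v i = ∑ σ, w σ * ∑ i, u i * v i := by rw [← Finset.sum_mul, hw1, one_mul]
    _ ≤ ∑ σ, w σ * ∑ i, u (h (σ i)) * v i :=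
      Finset.sum_le_sum fun σ _ => mul_le_mul_of_nonneg_left (key σ) (hw0 σ)
    _ = _ := by
      simp only [Finset.mul_sum]
      rw [Finset.sum_comm]
      refine Finset.sum_congr rfl fun i _ => ?_
      simp only [Matrix.sum_apply, Matrix.smul_apply, Finset.sum_mul]
      rw [Finset.sum_comm]
      refine Finset.sum_congr rfl fun σ _ => ?_
      rw [← Finset.sum_mul]
      simp [Equiv.Perm.permMatrix, PEquiv.toMatrix_apply, mul_assoc, Equiv.toPEquiv_apply, eq_comm]

/-- A form of Schur concavity of the entropy, with majorization expressed by linear functionals. -/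
lemma sum_neg_mul_log_le {n : Type*} [Fintype n] {q r : n → ℝ} (hq : ∀ j, 0 ≤ q j)
    (hr : ∀ j, 0 ≤ r j)
    (h : ∀ c : n → ℝ, ∃ τ : Equiv.Perm n, ∑ j, q j * c (τ j) ≤ ∑ j, r j * c j) :
    ∑ j, -q j * Real.log (q j) ≤ ∑ j, -r j * Real.log (r j) := by
  have hsum : ∑ j, r j ≤ ∑ j, q j := by
    obtain ⟨_, hτ⟩ := h fun _ => -1
    simpa using hτ
  set M := ∑ j, |1 - Real.log (q j)| with hM
  obtain ⟨τ, hτ⟩ := h fun j => if r j = 0 then M else -Real.log (r j)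
  have term : ∀ j, -q j * Real.log (q j) ≤
      q j * (if r (τ j) = 0 then M else -Real.log (r (τ j))) + (r (τ j) - q j) := by
    intro j
    rcases (hq j).eq_or_lt with h0 | h0
    · simpa [← h0] using hr (τ j)
    split_ifs with h1
    · have : 1 - Real.log (q j) ≤ M := (le_abs_self _).trans
        (Finset.single_le_sum (f := fun j => |1 - Real.log (q j)|)
          (fun _ _ => abs_nonneg _) (Finset.mem_univ j))
      rw [h1]
      nlinarith
    · have h2 : 0 < r (τ j) := (hr _).lt_of_ne' h1
      have := Real.log_le_sub_one_of_pos (div_pos h2 h0)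
      rw [Real.log_div h2.ne' h0.ne'] at this
      have := mul_le_mul_of_nonneg_left this h0.le
      have e : q j * (r (τ j) / q j - 1) = r (τ j) - q j := by field_simp
      nlinarith
  calc ∑ j, -q j * Real.log (q j) ≤ _ := Finset.sum_le_sum fun j _ => term j
    _ = ∑ j, q j * (if r (τ j) = 0 then M else -Real.log (r (τ j))) +
        (∑ j, r j - ∑ j, q j) := by
      rw [Finset.sum_add_distrib, Finset.sum_sub_distrib, Equiv.sum_comp τ r]
    _ ≤ ∑ j, r j * (if r j = 0 then M else -Real.log (r j)) := by linarith
    _ = _ := by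
      refine Finset.sum_congr rfl fun j _ => ?_
      split_ifs with h1
      · simp [h1]
      · ring

lemma vnEntropy_diagonal {n : Type*} [Fintype n] [DecidableEq n] (d : n → ℝ) :
    vnEntropy (Matrix.diagonal fun i => (d i : ℂ)) = ∑ i, -d i * Real.log (d i) := by
  have hM : (Matrix.diagonal fun i => (d i : ℂ)).IsHermitian :=
    Matrix.isHermitian_diagonal_of_self_adjoint _ (by ext; simp)
  rw [vnEntropy, dif_pos hM]
  have h := hM.roots_charpoly_eq_eigenvalues
  rw [Matrix.charpoly_diagonal, Polynomial.roots_prod _ _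
    (by simp [Finset.prod_ne_zero_iff, Polynomial.X_sub_C_ne_zero])] at h
  have h' := congrArg (fun s : Multiset ℂ =>
    (s.map fun z => -z.re * Real.log z.re).sum) h
  simpa using h'.symm

lemma isHermitian_ptraceProd {dA dB : ℕ} {M : Matrix (Fin dA × Fin dB) (Fin dA × Fin dB) ℂ}
    (hM : M.IsHermitian) : (ptraceProd dA dB M).IsHermitian := by
  ext b b'
  simp only [Matrix.conjTranspose_apply, AQD.ptraceProd, star_sum]
  exact Finset.sum_congr rfl fun a _ => hM.apply _ _

open scoped Kronecker in
lemma ptraceProd_conj_kronecker {dA dB : ℕ} (M : Matrix (Fin dA × Fin dB) (Fin dA × Fin dB) ℂ)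
    (V : Matrix (Fin dB) (Fin dB) ℂ) :
    ptraceProd dA dB (((1 : Matrix (Fin dA) (Fin dA) ℂ) ⊗ₖ V) * M *
      ((1 : Matrix (Fin dA) (Fin dA) ℂ) ⊗ₖ V)ᴴ) = V * ptraceProd dA dB M * Vᴴ := by
  ext b b'
  simp only [ptraceProd, Matrix.mul_apply, Matrix.conjTranspose_apply, Fintype.sum_prod_type,
    Matrix.kronecker_apply, Matrix.one_apply, ite_mul, one_mul, zero_mul, Finset.sum_mul,
    Finset.mul_sum, apply_ite star, star_zero, mul_ite, mul_zero, Finset.sum_ite_irrel,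
    Finset.sum_const_zero, Finset.sum_ite_eq, Finset.mem_univ, if_true]
  rw [Finset.sum_comm]
  refine Finset.sum_congr rfl fun _ _ => ?_
  rw [Finset.sum_comm]

lemma mul_diagonal_mul_conjTranspose_apply_self {n : Type*} [Fintype n] [DecidableEq n]
    (W : Matrix n n ℂ) (d : n → ℝ) (x : n) :
    (W * Matrix.diagonal (fun i => (d i : ℂ)) * Wᴴ) x x =
      ((∑ y, Complex.normSq (W x y) * d y : ℝ) : ℂ) := by
  rw [Matrix.mul_apply]
  push_cast
  refine Finset.sum_congr rfl fun y _ => ?_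
  rw [Matrix.mul_diagonal, Matrix.conjTranspose_apply, RCLike.star_def, mul_right_comm,
    Complex.mul_conj]

lemma eq_mul_diagonal_mul_conjTranspose {n : Type*} [Fintype n] [DecidableEq n]
    {A : Matrix n n ℂ} (hA : A.IsHermitian) :
    A = (hA.eigenvectorUnitary : Matrix n n ℂ) *
      Matrix.diagonal (fun i => (hA.eigenvalues i : ℂ)) *
      (hA.eigenvectorUnitary : Matrix n n ℂ)ᴴ := by
  conv_lhs => rw [hA.spectral_theorem, Unitary.conjStarAlgAut_apply]
  rfl

lemma conjTranspose_mul_mul_eq_diagonal {n : Type*} [Fintype n] [DecidableEq n]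
    {A : Matrix n n ℂ} (hA : A.IsHermitian) :
    (hA.eigenvectorUnitary : Matrix n n ℂ)ᴴ * A * (hA.eigenvectorUnitary : Matrix n n ℂ) =
      Matrix.diagonal (fun i => (hA.eigenvalues i : ℂ)) := by
  have h := hA.conjStarAlgAut_star_eigenvectorUnitary
  rw [Unitary.conjStarAlgAut_star_apply] at h
  exact h

open scoped Kronecker in
/-- The spectrum of a partial trace is obtained from the full spectrum by a doubly stochastic
matrix followed by summation over the traced-out index. -/
lemma exists_doublyStochastic_eigenvalues_ptraceProd {dA dB : ℕ}
    {ρ : Matrix (Fin dA × Fin dB) (Fin dA × Fin dB) ℂ} (hρ : ρ.IsHermitian)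
    {U : Matrix (Fin dA × Fin dB) (Fin dA × Fin dB) ℂ}
    (hU : U ∈ Matrix.unitaryGroup (Fin dA × Fin dB) ℂ)
    (hσ : (ptraceProd dA dB (U * ρ * Uᴴ)).IsHermitian) :
    ∃ D ∈ doublyStochastic ℝ (Fin dA × Fin dB), ∀ j,
      hσ.eigenvalues j = ∑ a, ∑ y, D (a, j) y * hρ.eigenvalues y := by
  set V : Matrix (Fin dB) (Fin dB) ℂ := (hσ.eigenvectorUnitary : Matrix _ _ ℂ)ᴴ with hV
  have hVu : V ∈ Matrix.unitaryGroup (Fin dB) ℂ := Unitary.star_mem hσ.eigenvectorUnitary.2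
  set K := (1 : Matrix (Fin dA) (Fin dA) ℂ) ⊗ₖ V
  have hK : K ∈ Matrix.unitaryGroup (Fin dA × Fin dB) ℂ :=
    Matrix.kronecker_mem_unitary (one_mem _) hVu
  set E := (hρ.eigenvectorUnitary : Matrix (Fin dA × Fin dB) (Fin dA × Fin dB) ℂ) with hE
  have hW : K * U * E ∈ Matrix.unitaryGroup (Fin dA × Fin dB) ℂ :=
    mul_mem (mul_mem hK hU) hρ.eigenvectorUnitary.2
  refine ⟨_, normSq_mem_doublyStochastic hW, fun j => ?_⟩
  have h1 := conjTranspose_mul_mul_eq_diagonal hσ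
  have h2 := ptraceProd_conj_kronecker (U * ρ * Uᴴ) V
  rw [hV, Matrix.conjTranspose_conjTranspose, h1] at h2
  have h3 := congrFun (congrFun h2 j) j
  rw [Matrix.diagonal_apply_eq] at h3
  have h4 : K * (U * ρ * Uᴴ) * Kᴴ = (K * U * E) *
      Matrix.diagonal (fun i => (hρ.eigenvalues i : ℂ)) * (K * U * E)ᴴ := by
    conv_lhs => rw [eq_mul_diagonal_mul_conjTranspose hρ]
    simp only [Matrix.conjTranspose_mul, Matrix.mul_assoc, hE]
  change ptraceProd dA dB (K * (U * ρ * Uᴴ) * Kᴴ) j j = _ at h3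
  rw [h4] at h3
  simp only [ptraceProd, mul_diagonal_mul_conjTranspose_apply_self] at h3
  simp only [Matrix.of_apply]
  exact_mod_cast h3.symm

lemma idx2_bijective (dA dB : ℕ) :
    Function.Bijective fun x : Fin dA × Fin dB => idx2 dA dB x.2 x.1 := by
  rw [Fintype.bijective_iff_injective_and_card]
  refine ⟨?_, by simp⟩
  rintro ⟨a, b⟩ ⟨a', b'⟩ h
  have h : (finProdFinEquiv (b, a) : ℕ) = finProdFinEquiv (b', a') := by
    have := congrArg Fin.val h
    simp only [idx2] at this
    simp only [finProdFinEquiv_apply_val]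
    linarith
  have := finProdFinEquiv.injective (Fin.ext h)
  simp_all

lemma idx2_le_idx2 {dA dB : ℕ} {b b' : Fin dB} (h : b < b') (a a' : Fin dA) :
    idx2 dA dB b a ≤ idx2 dA dB b' a' := by
  have : ((b : ℕ) + 1) * dA ≤ b' * dA := Nat.mul_le_mul_right _ h
  simp only [idx2, Fin.mk_le_mk]
  have := a.isLt
  linarith

/-- **Tensor-product case, achievability part.** For `ρ` Hermitian, positive semidefinite with
trace `1` on `Fin dA × Fin dB`, eigenvalues `p` listed in decreasing order and
`q j = ∑_a p (j * dA + a)`, the value `∑_j (- q j * log (q j))` is attained by some unitary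
`U` and is the minimum of `S(Tr_A (U ρ U*))` over all unitaries `U`. -/
theorem tensor_entropy_min (dA dB : ℕ) (hA : 1 ≤ dA) (hB : 1 ≤ dB)
    (ρ : Matrix (Fin dA × Fin dB) (Fin dA × Fin dB) ℂ)
    (hρ : ρ.IsHermitian) (hpos : ρ.PosSemidef) (htr : Matrix.trace ρ = 1)
    (p : Fin (dA * dB) → ℝ) (hp : Antitone p)
    (e : Fin (dA * dB) ≃ (Fin dA × Fin dB)) (hpe : ∀ i, p i = hρ.eigenvalues (e i)) :
    IsLeast
      (Set.range fun U : Matrix.unitaryGroup (Fin dA × Fin dB) ℂ =>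
        vnEntropy (ptraceProd dA dB ((U : Matrix _ _ ℂ) * ρ * (U : Matrix _ _ ℂ)ᴴ)))
      (∑ j : Fin dB, (- (∑ a : Fin dA, p (idx2 dA dB j a)) *
        Real.log (∑ a : Fin dA, p (idx2 dA dB j a)))) := by
  set k : Fin dA × Fin dB ≃ Fin (dA * dB) := Equiv.ofBijective _ (idx2_bijective dA dB) with hk
  have hk' : ∀ a b, k (a, b) = idx2 dA dB b a := fun _ _ => rfl
  set q : Fin dB → ℝ := fun j => ∑ a, p (idx2 dA dB j a) with hq
  have hp0 : ∀ i, 0 ≤ p i := fun i => hpe i ▸ hpos.eigenvalues_nonneg _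
  have heig : ∀ y, hρ.eigenvalues y = p (e.symm y) := fun y => by simp [hpe]
  constructor
  · set E := (hρ.eigenvectorUnitary : Matrix (Fin dA × Fin dB) (Fin dA × Fin dB) ℂ) with hE
    have hEu : Eᴴ * E = 1 := Unitary.coe_star_mul_self hρ.eigenvectorUnitary
    have hEu' : E * Eᴴ = 1 := Unitary.coe_mul_star_self hρ.eigenvectorUnitary
    set g := k.trans e
    have hU : Eᴴ.submatrix g id ∈ Matrix.unitaryGroup (Fin dA × Fin dB) ℂ := by
      rw [Matrix.mem_unitaryGroup_iff, Matrix.star_eq_conjTranspose,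
        Matrix.conjTranspose_submatrix, Matrix.conjTranspose_conjTranspose,
        ← Matrix.submatrix_mul _ _ _ _ _ Function.bijective_id, hEu]
      simp
    refine ⟨⟨_, hU⟩, ?_⟩
    have h1 : Eᴴ.submatrix g id * ρ * (Eᴴ.submatrix g id)ᴴ =
        Matrix.diagonal fun x => (p (k x) : ℂ) := by
      have h2 := congrArg (fun M => Matrix.submatrix M g g)
        (conjTranspose_mul_mul_eq_diagonal hρ)
      rw [Matrix.submatrix_mul _ _ _ id _ Function.bijective_id,
        Matrix.submatrix_mul _ _ _ id _ Function.bijective_id, Matrix.submatrix_id_id,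
        Matrix.submatrix_diagonal_equiv] at h2
      rw [Matrix.conjTranspose_submatrix, Matrix.conjTranspose_conjTranspose, h2]
      congr 1
      ext x
      simp [heig, g]
    have h3 : ptraceProd dA dB (Matrix.diagonal fun x => (p (k x) : ℂ)) =
        Matrix.diagonal fun j => (q j : ℂ) := by
      ext b b'
      by_cases hb : b = b'
      · subst hb
        simp [ptraceProd, hq, hk']
      · simp [ptraceProd, hb]
    change vnEntropy (ptraceProd dA dB (Eᴴ.submatrix g id * ρ * (Eᴴ.submatrix g id)ᴴ)) = _
    rw [h1, h3, vnEntropy_diagonal]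
  · rintro _ ⟨⟨U, hU⟩, rfl⟩
    have hσ : (ptraceProd dA dB (U * ρ * Uᴴ)).IsHermitian :=
      isHermitian_ptraceProd (Matrix.isHermitian_mul_mul_conjTranspose U hρ)
    obtain ⟨D, hD, hDe⟩ := exists_doublyStochastic_eigenvalues_ptraceProd hρ hU hσ
    change _ ≤ vnEntropy (ptraceProd dA dB (U * ρ * Uᴴ))
    rw [vnEntropy, dif_pos hσ]
    refine sum_neg_mul_log_le (q := q) (fun j => Finset.sum_nonneg fun _ _ => hp0 _)
      (fun j => ?_) fun c => ⟨Tuple.sort c, ?_⟩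
    · rw [hDe]
      exact Finset.sum_nonneg fun _ _ => Finset.sum_nonneg fun _ _ =>
        mul_nonneg (nonneg_of_mem_doublyStochastic hD) (hpos.eigenvalues_nonneg _)
    set τ := Tuple.sort c
    have hc : Monotone (c ∘ τ) := Tuple.monotone_sort c
    set s : Equiv.Perm (Fin dA × Fin dB) := Equiv.prodCongr (Equiv.refl _) τ
    have hanti : Antivary (fun x => p (k (s.symm x))) fun x : Fin dA × Fin dB => c x.2 := by
      rintro ⟨a, b⟩ ⟨a', b'⟩ hlt
      refine hp (idx2_le_idx2 (lt_of_not_ge fun hge => ?_) _ _)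
      have := hc hge
      simp only [s, Equiv.prodCongr_symm, Equiv.prodCongr_apply, Function.comp_apply,
        Prod.map_apply, Equiv.apply_symm_apply] at this
      exact this.not_gt hlt
    have h := sum_mul_le_of_mem_doublyStochastic hD hanti (e.symm.trans (k.symm.trans s))
    simp only [Equiv.trans_apply, Equiv.symm_apply_apply, Equiv.apply_symm_apply, ← heig] at h
    refine le_trans (le_of_eq ?_) (h.trans (le_of_eq ?_))
    · rw [← Equiv.sum_comp s, Fintype.sum_prod_type_right]
      simp only [Equiv.symm_apply_apply, hk', hq, Finset.sum_mul]
      rfl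
    · rw [Fintype.sum_prod_type_right]
      simp only [hDe, Finset.sum_mul]

end AQD
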